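/- Let E_P[f] = (1/C_n)·Σ_{σ ∈ S_n(123)} f(σ) and E_Q[f] = (1/C_n)·Σ_{τ ∈ S_n(132)} f(τ). Then: (1) for every n, E_P[σ(1)] = E_P[σ^{-1}(1)] = E_Q[τ(1)] = E_Q[τ^{-1}(1)], and this common value satisfies E_P[σ(1)] − (n−2) → 0 as n → ∞; (2) for every n, E_P[σ(n)] = E_P[σ^{-1}(n)], and E_P[σ(n)] → 3 as n → ∞; (3) for every n, E_Q[τ(n)] = E_Q[τ^{-1}(n)] = (n+1)/2. -/

import Mathlib

open Filter Finset Real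

/-- `σ` contains the pattern `τ`. -/
def ContainsPattern {n m : ℕ} (σ : Equiv.Perm (Fin n)) (τ : Equiv.Perm (Fin m)) : Prop :=
  ∃ f : Fin m → Fin n, StrictMono f ∧ ∀ a b : Fin m, σ (f a) < σ (f b) ↔ τ a < τ b

/-- `σ` avoids the pattern `τ`. -/
def Avoids {n m : ℕ} (σ : Equiv.Perm (Fin n)) (τ : Equiv.Perm (Fin m)) : Prop :=
  ¬ ContainsPattern σ τ

/-- The pattern (1,2,3) ∈ S₃ (0-indexed: 0,1,2). -/
def pattern123 : Equiv.Perm (Fin 3) := 1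

/-- The pattern (1,3,2) ∈ S₃ (0-indexed: 0,2,1). -/
def pattern132 : Equiv.Perm (Fin 3) := Equiv.swap 1 2

/-- The pattern (3,2,1) ∈ S₃ (0-indexed: 2,1,0). -/
def pattern321 : Equiv.Perm (Fin 3) := Equiv.swap 0 2

/-- The pattern (2,3,1) ∈ S₃ (0-indexed: 1,2,0). -/
def pattern231 : Equiv.Perm (Fin 3) := (Equiv.swap 1 2).trans (Equiv.swap 0 1)

attribute [local instance] Classical.propDecidable

/-- The expectation `(1/C_n) Σ_{σ ∈ S_n(123)} f(σ)`. -/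
noncomputable def EP (n : ℕ) (f : Equiv.Perm (Fin n) → ℝ) : ℝ :=
  (∑ σ ∈ Finset.univ.filter (fun σ : Equiv.Perm (Fin n) => Avoids σ pattern123), f σ) /
    (catalan n : ℝ)

/-- The expectation `(1/C_n) Σ_{τ ∈ S_n(132)} f(τ)`. -/
noncomputable def EQ (n : ℕ) (f : Equiv.Perm (Fin n) → ℝ) : ℝ :=
  (∑ τ ∈ Finset.univ.filter (fun τ : Equiv.Perm (Fin n) => Avoids τ pattern132), f τ) /
    (catalan n : ℝ)

lemma avoids123_iff {n : ℕ} (σ : Equiv.Perm (Fin n)) :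
    Avoids σ pattern123 ↔ ∀ i j k : Fin n, i < j → j < k → σ i < σ j → σ j < σ k → False := by
  unfold Avoids ContainsPattern pattern123
  constructor
  · intro h i j k hij hjk h1 h2
    apply h
    refine ⟨![i, j, k], ?_, ?_⟩
    · intro a b hab
      fin_cases a <;> fin_cases b <;> simp_all <;> exact hij.trans hjk
    · intro a b
      have h3 := h1.trans h2
      fin_cases a <;> fin_cases b <;> simp_all [le_of_lt]
  · rintro h ⟨f, hf, hp⟩
    refine h (f 0) (f 1) (f 2) (hf (by decide)) (hf (by decide)) ?_ ?_
    · rw [hp]; decide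
    · rw [hp]; decide

lemma avoids132_iff {n : ℕ} (σ : Equiv.Perm (Fin n)) :
    Avoids σ pattern132 ↔ ∀ i j k : Fin n, i < j → j < k → σ i < σ k → σ k < σ j → False := by
  have e0 : pattern132 0 = 0 := by decide
  have e1 : pattern132 1 = 2 := by decide
  have e2 : pattern132 2 = 1 := by decide
  unfold Avoids ContainsPattern
  constructor
  · intro h i j k hij hjk h1 h2
    apply h
    refine ⟨![i, j, k], ?_, ?_⟩
    · intro a b hab
      fin_cases a <;> fin_cases b <;> simp_all <;> exact hij.trans hjk
    · intro a b
      have h3 := h1.trans h2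
      fin_cases a <;> fin_cases b <;> simp_all [le_of_lt]
  · rintro h ⟨f, hf, hp⟩
    refine h (f 0) (f 1) (f 2) (hf (by decide)) (hf (by decide)) ?_ ?_
    · rw [hp, e0, e2]; decide
    · rw [hp, e1, e2]; decide

/-- Insert value `k` at position `p`. -/
def insAt {n : ℕ} (p k : Fin (n + 1)) (σ : Equiv.Perm (Fin n)) : Equiv.Perm (Fin (n + 1)) :=
  (finSuccEquiv' p).trans ((Equiv.optionCongr σ).trans (finSuccEquiv' k).symm)

@[simp] lemma insAt_self {n : ℕ} (p k : Fin (n + 1)) (σ : Equiv.Perm (Fin n)) :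
    insAt p k σ p = k := by
  simp [insAt]

@[simp] lemma insAt_succAbove {n : ℕ} (p k : Fin (n + 1)) (σ : Equiv.Perm (Fin n)) (i : Fin n) :
    insAt p k σ (p.succAbove i) = k.succAbove (σ i) := by
  simp [insAt]

lemma insAt_injective {n : ℕ} (p k : Fin (n + 1)) : Function.Injective (insAt p k) := by
  intro σ τ h
  ext i : 1
  have := congrArg (fun f => f (p.succAbove i)) h
  simpa using this

lemma insAt_surj {n : ℕ} (p : Fin (n + 1)) (τ : Equiv.Perm (Fin (n + 1))) :
    ∃ σ, insAt p (τ p) σ = τ := by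
  have hinj : Function.Injective
      (fun x : Fin (n + 1) × Equiv.Perm (Fin n) => insAt p x.1 x.2) := by
    rintro ⟨k, σ⟩ ⟨k', σ'⟩ h
    have h1 := congrArg (fun f => f p) h
    simp only [insAt_self] at h1
    subst h1
    have := insAt_injective p k h
    simpa using this
  have hb := (Fintype.bijective_iff_injective_and_card _).2 ⟨hinj, by
    simp [Fintype.card_perm, Nat.factorial_succ]⟩
  obtain ⟨⟨k, σ⟩, h⟩ := hb.2 τ
  refine ⟨σ, ?_⟩
  simp only at h
  rw [← h]; simp

lemma card_insAt {n : ℕ} (p k : Fin (n + 1)) (P : Equiv.Perm (Fin (n + 1)) → Prop)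
    (Q : Equiv.Perm (Fin n) → Prop) (hPQ : ∀ σ, P (insAt p k σ) ↔ Q σ)
    [DecidablePred fun τ : Equiv.Perm (Fin (n + 1)) => P τ ∧ τ p = k] [DecidablePred Q] :
    Finset.card (Finset.univ.filter fun τ : Equiv.Perm (Fin (n + 1)) => P τ ∧ τ p = k) =
      Finset.card (Finset.univ.filter Q) := by
  symm
  refine Finset.card_bij (fun σ _ => insAt p k σ) ?_ ?_ ?_
  · intro σ hσ; simpa [hPQ] using hσ
  · intro a _ b _ h; exact insAt_injective p k h
  · intro τ hτ
    simp only [mem_filter, mem_univ, true_and] at hτ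
    obtain ⟨σ, hσ⟩ := insAt_surj p τ
    rw [hτ.2] at hσ
    exact ⟨σ, by simpa [hσ, ← hPQ] using hτ.1, hσ⟩

/-! ### first entry -/

lemma succAbove_lt_iff' {n : ℕ} (k : Fin (n + 1)) (i j : Fin n) :
    k.succAbove i < k.succAbove j ↔ i < j := Fin.succAbove_lt_succAbove_iff

lemma lt_succAbove_val {n : ℕ} (k : Fin (n + 1)) (i : Fin n) :
    k < k.succAbove i ↔ (k : ℕ) ≤ i := by
  rw [Fin.lt_succAbove_iff_le_castSucc]; rfl

lemma succAbove_lt_val {n : ℕ} (k : Fin (n + 1)) (i : Fin n) :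
    k.succAbove i < k ↔ (i : ℕ) < k := by
  rw [Fin.succAbove_lt_iff_castSucc_lt]; rfl

@[simp] lemma insAt_zero_succ {n : ℕ} (k : Fin (n + 1)) (σ : Equiv.Perm (Fin n)) (i : Fin n) :
    insAt 0 k σ i.succ = k.succAbove (σ i) := by
  have := insAt_succAbove 0 k σ i
  simpa using this

lemma ins132 {n : ℕ} (k : Fin (n + 2)) (τ : Equiv.Perm (Fin (n + 1))) :
    Avoids (insAt 0 k τ) pattern132 ↔ Avoids τ pattern132 ∧ (τ 0 : ℕ) ≤ k := by
  rw [avoids132_iff, avoids132_iff]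
  constructor
  · intro h
    refine ⟨?_, ?_⟩
    · intro i j l hij hjl h1 h2
      refine h i.succ j.succ l.succ (by simpa using hij) (by simpa using hjl) ?_ ?_ <;>
        simpa [succAbove_lt_iff']
    · by_contra hk
      push Not at hk
      have hk' : (k : ℕ) < n + 1 := hk.trans (τ 0).2
      set i := τ⁻¹ ⟨k, hk'⟩ with hi
      have hτi : τ i = ⟨k, hk'⟩ := by simp [hi]
      have hi0 : i ≠ 0 := by
        intro h0
        rw [h0] at hτi
        rw [hτi] at hk
        simp at hk
      refine h 0 (Fin.succ 0) i.succ (by simp) (Fin.succ_lt_succ_iff.2 (Fin.pos_of_ne_zero hi0)) ?_ ?_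
      · simp only [insAt_self, insAt_zero_succ, lt_succAbove_val, hτi]; exact le_rfl
      · simp only [insAt_zero_succ, succAbove_lt_iff', hτi]
        exact hk
  · rintro ⟨h, hk⟩ x y z hxy hyz h1 h2
    obtain ⟨y, rfl⟩ := Fin.exists_succ_eq.2 (Fin.ne_zero_of_lt hxy)
    obtain ⟨z, rfl⟩ := Fin.exists_succ_eq.2 (Fin.ne_zero_of_lt hyz)
    have hyz' : y < z := by simpa using hyz
    have hz0 : z ≠ 0 := Fin.ne_zero_of_lt hyz'
    rcases Fin.eq_zero_or_eq_succ x with rfl | ⟨x, rfl⟩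
    · simp only [insAt_self, insAt_zero_succ, lt_succAbove_val, succAbove_lt_iff'] at h1 h2
      have hne : τ 0 ≠ τ z := fun e => hz0 (τ.injective e).symm
      have h3 : τ 0 < τ z := lt_of_le_of_ne (by rw [Fin.le_def]; omega) hne
      have hy0 : y ≠ 0 := by
        rintro rfl
        exact absurd (h3.trans h2) (lt_irrefl _)
      exact h 0 y z (Fin.pos_of_ne_zero hy0) hyz' h3 h2
    · simp only [insAt_zero_succ, succAbove_lt_iff'] at h1 h2
      exact h x y z (by simpa using hxy) hyz' h1 h2

lemma ins123 {n : ℕ} (k : Fin (n + 2)) (τ : Equiv.Perm (Fin (n + 1))) (hk : (τ 0 : ℕ) < k) :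
    Avoids (insAt 0 k τ) pattern123 ↔ Avoids τ pattern123 := by
  rw [avoids123_iff, avoids123_iff]
  constructor
  · intro h i j l hij hjl h1 h2
    refine h i.succ j.succ l.succ (by simpa using hij) (by simpa using hjl) ?_ ?_ <;>
        simpa [succAbove_lt_iff']
  · rintro h x y z hxy hyz h1 h2
    obtain ⟨y, rfl⟩ := Fin.exists_succ_eq.2 (Fin.ne_zero_of_lt hxy)
    obtain ⟨z, rfl⟩ := Fin.exists_succ_eq.2 (Fin.ne_zero_of_lt hyz)
    have hyz' : y < z := by simpa using hyz
    rcases Fin.eq_zero_or_eq_succ x with rfl | ⟨x, rfl⟩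
    · simp only [insAt_self, insAt_zero_succ, lt_succAbove_val, succAbove_lt_iff'] at h1 h2
      have h3 : τ 0 < τ y := by rw [Fin.lt_def]; omega
      have hy0 : y ≠ 0 := by
        rintro rfl
        exact absurd h3 (lt_irrefl _)
      exact h 0 y z (Fin.pos_of_ne_zero hy0) hyz' h3 h2
    · simp only [insAt_zero_succ, succAbove_lt_iff'] at h1 h2
      exact h x y z (by simpa using hxy) hyz' h1 h2

lemma ins123_max {n : ℕ} (τ : Equiv.Perm (Fin (n + 1))) :
    Avoids (insAt 1 (Fin.last (n + 1)) τ) pattern123 ↔ Avoids τ pattern123 := by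
  rw [avoids123_iff, avoids123_iff]
  constructor
  · intro h i j l hij hjl h1 h2
    refine h (Fin.succAbove 1 i) (Fin.succAbove 1 j) (Fin.succAbove 1 l)
      (by rwa [succAbove_lt_iff']) (by rwa [succAbove_lt_iff']) ?_ ?_ <;>
      rwa [insAt_succAbove, insAt_succAbove, succAbove_lt_iff']
  · rintro h x y z hxy hyz h1 h2
    have hx : x ≠ 1 := by
      rintro rfl
      rw [insAt_self] at h1
      exact absurd (Fin.le_last _) (not_le.2 h1)
    have hy : y ≠ 1 := by
      rintro rfl
      rw [insAt_self] at h2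
      exact absurd (Fin.le_last _) (not_le.2 h2)
    have hz : z ≠ 1 := by
      rintro rfl
      rw [Fin.lt_def] at hxy hyz
      have : ((1 : Fin (n + 2)) : ℕ) = 1 := rfl
      omega
    obtain ⟨x, rfl⟩ := Fin.exists_succAbove_eq hx
    obtain ⟨y, rfl⟩ := Fin.exists_succAbove_eq hy
    obtain ⟨z, rfl⟩ := Fin.exists_succAbove_eq hz
    rw [insAt_succAbove, insAt_succAbove, succAbove_lt_iff'] at h1 h2
    rw [succAbove_lt_iff'] at hxy hyz
    exact h x y z hxy hyz h1 h2

/-- number of avoiders of size `n+1` with first entry `k` -/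
noncomputable def fcount (pt : Equiv.Perm (Fin 3)) (n k : ℕ) : ℕ :=
  #{σ : Equiv.Perm (Fin (n + 1)) | Avoids σ pt ∧ (σ 0 : ℕ) = k}

lemma fcount_le (pt : Equiv.Perm (Fin 3)) (n k : ℕ) :
    #{σ : Equiv.Perm (Fin (n + 1)) | Avoids σ pt ∧ (σ 0 : ℕ) ≤ k} =
      ∑ j ∈ range (k + 1), fcount pt n j := by
  rw [Finset.card_eq_sum_card_fiberwise (f := fun σ : Equiv.Perm (Fin (n + 1)) => (σ 0 : ℕ))
    (t := range (k + 1))]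
  · refine Finset.sum_congr rfl fun j hj => ?_
    unfold fcount
    congr 1
    ext σ
    simp only [mem_filter, mem_univ, true_and, mem_range] at hj ⊢
    constructor
    · rintro ⟨⟨h1, h2⟩, h3⟩; exact ⟨h1, h3⟩
    · rintro ⟨h1, h3⟩; exact ⟨⟨h1, by omega⟩, h3⟩
  · intro σ hσ
    simp at hσ ⊢
    omega

lemma fcount_big (pt : Equiv.Perm (Fin 3)) (n k : ℕ) (h : n < k) : fcount pt n k = 0 := by
  unfold fcount
  rw [Finset.card_eq_zero, Finset.filter_eq_empty_iff]
  rintro σ - ⟨_, h2⟩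
  have := (σ 0).2
  omega

lemma fcount132_succ (n k : ℕ) (hk : k ≤ n + 1) :
    fcount pattern132 (n + 1) k =
      #{σ : Equiv.Perm (Fin (n + 1)) | Avoids σ pattern132 ∧ (σ 0 : ℕ) ≤ k} := by
  have := card_insAt (0 : Fin (n + 2)) ⟨k, by omega⟩ (fun τ => Avoids τ pattern132)
    (fun σ => Avoids σ pattern132 ∧ (σ 0 : ℕ) ≤ k) (fun σ => ins132 _ σ)
  rw [← this]
  unfold fcount
  simp only [Fin.ext_iff]

lemma fcount123_succ (n k : ℕ) (hk : k ≤ n + 1) :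
    fcount pattern123 (n + 1) k =
      #{σ : Equiv.Perm (Fin (n + 1)) | Avoids σ pattern123 ∧ (σ 0 : ℕ) ≤ k} := by
  have h1 := card_insAt (0 : Fin (n + 2)) ⟨k, by omega⟩
    (fun τ => Avoids τ pattern123 ∧ (τ (Fin.succ 0) : ℕ) < k)
    (fun σ => Avoids σ pattern123 ∧ (σ 0 : ℕ) < k) (by
      intro σ
      have := succAbove_lt_val (⟨k, by omega⟩ : Fin (n + 2)) (σ 0)
      rw [Fin.lt_def] at this
      simp only [insAt_zero_succ] at this ⊢
      rw [this]
      constructor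
      · rintro ⟨a, b⟩; exact ⟨(ins123 _ _ b).1 a, b⟩
      · rintro ⟨a, b⟩; exact ⟨(ins123 _ _ b).2 a, b⟩)
  have h2 := card_insAt (1 : Fin (n + 2)) (Fin.last (n + 1))
    (fun τ => Avoids τ pattern123 ∧ (τ (Fin.succAbove 1 0) : ℕ) = k)
    (fun σ => Avoids σ pattern123 ∧ (σ 0 : ℕ) = k) (by
      intro σ
      simp only [insAt_succAbove, ins123_max]
      simp)
  have e3 : #{σ : Equiv.Perm (Fin (n + 1)) | Avoids σ pattern123 ∧ (σ 0 : ℕ) ≤ k} =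
      #{σ : Equiv.Perm (Fin (n + 1)) | Avoids σ pattern123 ∧ (σ 0 : ℕ) < k} +
      #{σ : Equiv.Perm (Fin (n + 1)) | Avoids σ pattern123 ∧ (σ 0 : ℕ) = k} := by
    rw [← Finset.card_union_of_disjoint]
    · congr 1
      ext σ
      simp only [mem_filter, mem_univ, true_and, mem_union, le_iff_lt_or_eq]
      tauto
    · rw [Finset.disjoint_filter]
      rintro σ - ⟨_, h⟩ ⟨_, h'⟩
      omega
  rw [e3, ← h1, ← h2]
  unfold fcount
  rw [← Finset.card_union_of_disjoint]
  · congr 1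
    ext σ
    simp only [mem_filter, mem_univ, true_and, mem_union]
    have z0 : (Fin.succAbove (1 : Fin (n + 2)) (0 : Fin (n + 1))) = 0 := by
      exact Fin.succAbove_ne_zero_zero (by simp)
    have z1 : Fin.succ (0 : Fin (n + 1)) = 1 := rfl
    rw [z0, z1]
    constructor
    · rintro ⟨ha, hk⟩
      by_cases hlt : (σ 1 : ℕ) < k
      · exact Or.inl ⟨⟨ha, hlt⟩, Fin.ext hk⟩
      · refine Or.inr ⟨⟨ha, hk⟩, ?_⟩
        by_contra hne
        rw [avoids123_iff] at ha
        have hl : σ (σ⁻¹ (Fin.last (n + 1))) = Fin.last (n + 1) := by simp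
        have hne01 : σ 0 ≠ σ 1 := fun e => by simpa using σ.injective e
        have hk1 : (σ 0 : ℕ) ≠ σ 1 := fun e => hne01 (Fin.ext e)
        have hi1 : σ⁻¹ (Fin.last (n + 1)) ≠ 1 := by
          intro e; rw [e] at hl; exact hne hl
        have h01 : σ 0 < σ 1 := by rw [Fin.lt_def]; omega
        have hi0 : σ⁻¹ (Fin.last (n + 1)) ≠ 0 := by
          intro e; rw [e] at hl; rw [hl] at h01
          exact absurd (Fin.le_last _) (not_le.2 h01)
        refine ha 0 1 (σ⁻¹ (Fin.last (n + 1))) (by simp) ?_ h01 ?_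
        · have a1 : ((σ⁻¹ (Fin.last (n + 1)) : Fin (n+2)) : ℕ) ≠ 1 := fun e => hi1 (Fin.ext e)
          have a0 : ((σ⁻¹ (Fin.last (n + 1)) : Fin (n+2)) : ℕ) ≠ 0 := fun e => hi0 (Fin.ext e)
          rw [Fin.lt_def]
          have : ((1 : Fin (n + 2)) : ℕ) = 1 := rfl
          omega
        · rw [hl]; exact lt_of_le_of_ne (Fin.le_last _) hne
    · rintro (⟨⟨ha, _⟩, h⟩ | ⟨⟨ha, h⟩, _⟩)
      · exact ⟨ha, by rw [h]⟩
      · exact ⟨ha, h⟩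
  · rw [Finset.disjoint_filter]
    rintro σ - ⟨⟨_, h⟩, _⟩ ⟨_, h'⟩
    have z1 : Fin.succ (0 : Fin (n + 1)) = 1 := rfl
    rw [z1, h'] at h
    simp at h
    omega

lemma avoids_of_small {n : ℕ} (hn : n < 3) (σ : Equiv.Perm (Fin n)) (pt : Equiv.Perm (Fin 3)) :
    Avoids σ pt := by
  rintro ⟨f, hf, _⟩
  have := Fintype.card_le_of_injective f hf.injective
  simp at this
  omega

lemma fcount_eq (n : ℕ) : ∀ k, fcount pattern123 n k = fcount pattern132 n k := by
  induction n with
  | zero =>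
    intro k
    unfold fcount
    simp [avoids_of_small]
  | succ n ih =>
    intro k
    by_cases hk : k ≤ n + 1
    · rw [fcount123_succ n k hk, fcount132_succ n k hk, fcount_le, fcount_le]
      exact Finset.sum_congr rfl fun j _ => ih j
    · rw [fcount_big _ _ _ (by omega), fcount_big _ _ _ (by omega)]

lemma sum_first (pt : Equiv.Perm (Fin 3)) (n : ℕ) (g : ℕ → ℝ) :
    ∑ σ ∈ Finset.univ.filter (fun σ : Equiv.Perm (Fin (n + 1)) => Avoids σ pt), g (σ 0 : ℕ) =
      ∑ k ∈ range (n + 1), (fcount pt n k : ℝ) * g k := by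
  rw [← Finset.sum_fiberwise_of_maps_to (g := fun σ : Equiv.Perm (Fin (n + 1)) => (σ 0 : ℕ))
    (t := range (n + 1)) (by intro σ _; simpa using (σ 0).is_le)]
  refine Finset.sum_congr rfl fun k _ => ?_
  rw [Finset.sum_congr rfl (g := fun _ => g k), Finset.sum_const, nsmul_eq_mul]
  · unfold fcount
    congr 3
    ext σ; simp
  · intro σ hσ
    rw [(Finset.mem_filter.1 hσ).2]

lemma sum_first_eq (n : ℕ) (g : ℕ → ℝ) :
    ∑ σ ∈ Finset.univ.filter (fun σ : Equiv.Perm (Fin (n + 1)) => Avoids σ pattern123),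
        g (σ 0 : ℕ) =
    ∑ σ ∈ Finset.univ.filter (fun σ : Equiv.Perm (Fin (n + 1)) => Avoids σ pattern132),
        g (σ 0 : ℕ) := by
  simp only [sum_first, fcount_eq]

/-- number of avoiders -/
noncomputable def qcount (n : ℕ) : ℕ := #{σ : Equiv.Perm (Fin n) | Avoids σ pattern132}

lemma qcount_succ_eq (n : ℕ) : qcount (n + 1) = ∑ k ∈ range (n + 1), fcount pattern132 n k := by
  rw [← fcount_le]
  unfold qcount
  congr 1
  ext σ
  have := (σ 0).is_le
  simp [this]

lemma sum_first132 (n : ℕ) :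
    ∑ σ ∈ Finset.univ.filter (fun σ : Equiv.Perm (Fin (n + 1)) => Avoids σ pattern132),
      ((n : ℝ) + 2 - (σ 0 : ℕ)) = qcount (n + 2) := by
  rw [qcount_succ_eq]
  rw [Finset.sum_congr rfl (fun k hk => fcount132_succ n k (by simp at hk; omega))]
  simp only [Finset.card_filter]
  rw [Finset.sum_comm, Finset.sum_filter]
  push_cast
  refine Finset.sum_congr rfl fun σ _ => ?_
  by_cases h : Avoids σ pattern132
  · simp only [h, if_true, true_and]
    rw [← Finset.sum_filter]
    simp only [Finset.sum_const, nsmul_eq_mul, mul_one]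
    have : (range (n + 1 + 1)).filter (fun k => (σ 0 : ℕ) ≤ k) = Finset.Ico (σ 0 : ℕ) (n + 2) := by
      ext k; simp; omega
    rw [this, Nat.card_Ico, Nat.cast_sub (by omega)]
    push_cast; ring
  · simp [h]

/-! ### last entry -/

/-- auxiliary identification used for skew sums -/
def skewE (a b : ℕ) : Fin a ⊕ Fin b ≃ Fin (a + b) :=
  finSumFinEquiv.trans (finAddFlip.trans (finCongr (Nat.add_comm b a)))

lemma skewE_inl (a b : ℕ) (i : Fin a) : (skewE a b (Sum.inl i) : ℕ) = b + i := by
  simp [skewE, add_comm]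

lemma skewE_inr (a b : ℕ) (i : Fin b) : (skewE a b (Sum.inr i) : ℕ) = i := by
  simp [skewE]

/-- skew sum -/
def skew {a b : ℕ} (A : Equiv.Perm (Fin a)) (B : Equiv.Perm (Fin b)) :
    Equiv.Perm (Fin (a + b)) :=
  finSumFinEquiv.symm.trans ((Equiv.Perm.sumCongr A B).trans (skewE a b))

lemma skew_left {a b : ℕ} (A : Equiv.Perm (Fin a)) (B : Equiv.Perm (Fin b)) (i : Fin a) :
    (skew A B (Fin.castAdd b i) : ℕ) = b + A i := by
  simp [skew, skewE_inl]

lemma skew_right {a b : ℕ} (A : Equiv.Perm (Fin a)) (B : Equiv.Perm (Fin b)) (i : Fin b) :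
    (skew A B (Fin.natAdd a i) : ℕ) = B i := by
  simp [skew, skewE_inr]

lemma skew_inj {a b : ℕ} (A A' : Equiv.Perm (Fin a)) (B B' : Equiv.Perm (Fin b))
    (h : skew A B = skew A' B') : A = A' ∧ B = B' := by
  constructor
  · ext i
    have h1 := skew_left A B i
    rw [h, skew_left] at h1
    omega
  · ext i
    have h1 := skew_right A B i
    rw [h, skew_right] at h1
    omega

lemma skew_surj {a b : ℕ} (σ : Equiv.Perm (Fin (a + b)))
    (h : ∀ i : Fin a, b ≤ (σ (Fin.castAdd b i) : ℕ)) : ∃ A B, skew A B = σ := by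
  have hm : Set.MapsTo (finSumFinEquiv.trans (σ.trans (skewE a b).symm))
      (Set.range Sum.inl) (Set.range Sum.inl) := by
    rintro _ ⟨i, rfl⟩
    rcases hx : (finSumFinEquiv.trans (σ.trans (skewE a b).symm)) (Sum.inl i) with x | y
    · exact ⟨x, rfl⟩
    · exfalso
      simp only [Equiv.trans_apply, finSumFinEquiv_apply_left, Equiv.symm_apply_eq] at hx
      have h1 := h i
      rw [hx, skewE_inr] at h1
      exact absurd y.2 (not_lt.2 h1)
  obtain ⟨⟨A, B⟩, hAB⟩ := Equiv.Perm.mem_sumCongrHom_range_of_perm_mapsTo_inl hm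
  refine ⟨A, B, ?_⟩
  have h2 : Equiv.Perm.sumCongr A B = finSumFinEquiv.trans (σ.trans (skewE a b).symm) := hAB
  unfold skew
  rw [h2]
  ext i
  simp

@[simp] lemma insAt_last_castSucc {n : ℕ} (k : Fin (n + 1)) (σ : Equiv.Perm (Fin n)) (i : Fin n) :
    insAt (Fin.last n) k σ i.castSucc = k.succAbove (σ i) := by
  have := insAt_succAbove (Fin.last n) k σ i
  simpa using this

/-- the middle value -/
def mid (a b : ℕ) : Fin (a + b + 1) := ⟨b, by omega⟩

lemma skew_of_avoids {a b : ℕ} (σ : Equiv.Perm (Fin (a + b)))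
    (h : Avoids (insAt (Fin.last (a + b)) (mid a b) σ) pattern132) : ∃ A B, skew A B = σ := by
  rw [avoids132_iff] at h
  apply skew_surj
  intro i
  by_contra hi
  push Not at hi
  have hall : ∀ j, Fin.castAdd b i ≤ j → (σ j : ℕ) < b := by
    intro j hj
    rcases eq_or_lt_of_le hj with rfl | hj
    · exact hi
    · by_contra hjb
      push Not at hjb
      refine h (Fin.castAdd b i).castSucc j.castSucc (Fin.last _) (by simpa using hj)
        (Fin.castSucc_lt_last _) ?_ ?_
      · rw [insAt_self, insAt_last_castSucc, succAbove_lt_val]; exact hi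
      · rw [insAt_self, insAt_last_castSucc, lt_succAbove_val]; exact hjb
  have hc : (Finset.Ici (Fin.castAdd b i)).card ≤ (range b).card := by
    apply Finset.card_le_card_of_injOn (fun j => (σ j : ℕ))
    · intro j hj
      simpa using hall j (by simpa using hj)
    · intro x _ y _ hxy
      exact σ.injective (Fin.ext hxy)
  rw [Fin.card_Ici, card_range] at hc
  have := i.2
  simp at hc
  omega

lemma avoids_ins_skew {a b : ℕ} (A : Equiv.Perm (Fin a)) (B : Equiv.Perm (Fin b)) :
    Avoids (insAt (Fin.last (a + b)) (mid a b) (skew A B)) pattern132 ↔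
      Avoids A pattern132 ∧ Avoids B pattern132 := by
  rw [avoids132_iff, avoids132_iff, avoids132_iff]
  constructor
  · intro h
    constructor
    · intro i j k hij hjk h1 h2
      refine h (Fin.castAdd b i).castSucc (Fin.castAdd b j).castSucc (Fin.castAdd b k).castSucc
        hij hjk ?_ ?_
      · rw [insAt_last_castSucc, insAt_last_castSucc, succAbove_lt_iff', Fin.lt_def, skew_left,
          skew_left]
        simpa using h1
      · rw [insAt_last_castSucc, insAt_last_castSucc, succAbove_lt_iff', Fin.lt_def, skew_left,
          skew_left]
        simpa using h2
    · intro i j k hij hjk h1 h2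
      refine h (Fin.natAdd a i).castSucc (Fin.natAdd a j).castSucc (Fin.natAdd a k).castSucc
        (by simpa using hij) (by simpa using hjk) ?_ ?_
      · rw [insAt_last_castSucc, insAt_last_castSucc, succAbove_lt_iff', Fin.lt_def, skew_right,
          skew_right]
        simpa using h1
      · rw [insAt_last_castSucc, insAt_last_castSucc, succAbove_lt_iff', Fin.lt_def, skew_right,
          skew_right]
        simpa using h2
  · rintro ⟨hA, hB⟩ x y z hxy hyz h1 h2
    have hy : y ≠ Fin.last _ := Fin.ne_last_of_lt hyz
    have hx : x ≠ Fin.last _ := Fin.ne_last_of_lt hxy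
    obtain ⟨x, rfl⟩ := Fin.exists_castSucc_eq.2 hx
    obtain ⟨y, rfl⟩ := Fin.exists_castSucc_eq.2 hy
    rcases Fin.eq_castSucc_or_eq_last z with ⟨z, rfl⟩ | rfl
    · rw [insAt_last_castSucc, insAt_last_castSucc, succAbove_lt_iff', Fin.lt_def] at h1 h2
      rw [Fin.castSucc_lt_castSucc_iff, Fin.lt_def] at hxy hyz
      induction x using Fin.addCases <;> induction y using Fin.addCases <;>
        induction z using Fin.addCases <;>
        simp only [skew_left, skew_right, Fin.val_castAdd, Fin.val_natAdd] at h1 h2 hxy hyz <;>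
        first
        | omega
        | exact hA _ _ _ (Fin.lt_def.2 hxy) (Fin.lt_def.2 hyz) (Fin.lt_def.2 (by omega))
            (Fin.lt_def.2 (by omega))
        | exact hB _ _ _ (Fin.lt_def.2 (by omega)) (Fin.lt_def.2 (by omega)) (Fin.lt_def.2 h1)
            (Fin.lt_def.2 h2)
    · rw [insAt_self, insAt_last_castSucc] at h1 h2
      rw [succAbove_lt_val] at h1
      rw [lt_succAbove_val] at h2
      rw [Fin.castSucc_lt_castSucc_iff, Fin.lt_def] at hxy
      simp only [mid] at h1 h2
      induction x using Fin.addCases <;> induction y using Fin.addCases <;>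
        simp only [skew_left, skew_right, Fin.val_castAdd, Fin.val_natAdd] at h1 h2 hxy <;>
        omega

lemma lcount (a b : ℕ) :
    #{τ : Equiv.Perm (Fin (a + b + 1)) | Avoids τ pattern132 ∧ (τ (Fin.last (a + b)) : ℕ) = b} =
      qcount a * qcount b := by
  unfold qcount
  rw [← Finset.card_product]
  symm
  refine Finset.card_bij (fun x _ => insAt (Fin.last (a + b)) (mid a b) (skew x.1 x.2)) ?_ ?_ ?_
  · intro x hx
    simp only [mem_product, mem_filter, mem_univ, true_and] at hx ⊢
    exact ⟨(avoids_ins_skew _ _).2 hx, by rw [insAt_self]; rfl⟩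
  · intro x _ y _ h
    have := skew_inj _ _ _ _ (insAt_injective _ _ h)
    exact Prod.ext this.1 this.2
  · intro τ hτ
    simp only [mem_filter, mem_univ, true_and] at hτ
    obtain ⟨σ, hσ⟩ := insAt_surj (Fin.last (a + b)) τ
    have e : τ (Fin.last (a + b)) = mid a b := Fin.ext hτ.2
    rw [e] at hσ
    rw [← hσ] at hτ
    obtain ⟨A, B, rfl⟩ := skew_of_avoids σ hτ.1
    refine ⟨(A, B), ?_, hσ⟩
    simp only [mem_product, mem_filter, mem_univ, true_and]
    exact (avoids_ins_skew A B).1 hτ.1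

lemma sum_last (n : ℕ) (g : ℕ → ℝ) :
    ∑ σ ∈ Finset.univ.filter (fun σ : Equiv.Perm (Fin (n + 1)) => Avoids σ pattern132),
      g (σ (Fin.last n) : ℕ) =
      ∑ x ∈ antidiagonal n, (qcount x.1 : ℝ) * qcount x.2 * g x.2 := by
  rw [← Finset.sum_fiberwise_of_maps_to
    (g := fun σ : Equiv.Perm (Fin (n + 1)) => (n - (σ (Fin.last n) : ℕ), (σ (Fin.last n) : ℕ)))
    (t := antidiagonal n)
    (by intro σ _; have := (σ (Fin.last n)).is_le; simp only [HasAntidiagonal.mem_antidiagonal]; omega)]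
  refine Finset.sum_congr rfl ?_
  rintro ⟨a, b⟩ hab
  rw [HasAntidiagonal.mem_antidiagonal] at hab
  simp only at hab
  subst hab
  rw [Finset.sum_congr rfl (g := fun _ => g b), Finset.sum_const, nsmul_eq_mul]
  · simp only
    rw [← Nat.cast_mul, ← lcount]
    congr 3
    ext σ
    simp only [mem_filter, mem_univ, true_and, Prod.mk.injEq]
    constructor
    · rintro ⟨h1, h2, h3⟩; exact ⟨h1, h3⟩
    · rintro ⟨h1, h3⟩; exact ⟨h1, by omega, h3⟩
  · intro σ hσ
    have := (Finset.mem_filter.1 hσ).2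
    simp only [Prod.mk.injEq] at this
    rw [this.2]

lemma qcount_succ' (n : ℕ) : qcount (n + 1) = ∑ x ∈ antidiagonal n, qcount x.1 * qcount x.2 := by
  have := sum_last n (fun _ => 1)
  simp only [sum_const, nsmul_eq_mul, mul_one] at this
  unfold qcount at this ⊢
  exact_mod_cast this

lemma qcount_eq (n : ℕ) : qcount n = catalan n := by
  induction n using Nat.strong_induction_on with
  | _ n ih =>
    cases n with
    | zero => simp [qcount, avoids_of_small]
    | succ n =>
      rw [qcount_succ', catalan_succ']
      refine Finset.sum_congr rfl fun x hx => ?_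
      rw [HasAntidiagonal.mem_antidiagonal] at hx
      rw [ih _ (by omega), ih _ (by omega)]

lemma catalan_pos' (n : ℕ) : (0 : ℝ) < catalan n := by
  have h := succ_mul_catalan_eq_centralBinom n
  have h2 := Nat.centralBinom_pos n
  rw [← h] at h2
  exact_mod_cast Nat.pos_of_mul_pos_left h2

lemma sum_last_val (n : ℕ) :
    ∑ σ ∈ Finset.univ.filter (fun σ : Equiv.Perm (Fin (n + 1)) => Avoids σ pattern132),
      (((σ (Fin.last n) : ℕ) : ℝ) + 1) = catalan (n + 1) * (((n : ℝ) + 2) / 2) := by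
  rw [sum_last n (fun k => (k : ℝ) + 1), catalan_succ']
  simp only [qcount_eq]
  have h := Finset.Nat.sum_antidiagonal_swap (n := n)
    (f := fun x : ℕ × ℕ => (catalan x.1 : ℝ) * catalan x.2 * ((x.2 : ℝ) + 1))
  simp only [Prod.fst_swap, Prod.snd_swap] at h
  have h2 : ∑ x ∈ antidiagonal n, (catalan x.2 : ℝ) * catalan x.1 * ((x.1 : ℝ) + 1) +
      ∑ x ∈ antidiagonal n, (catalan x.1 : ℝ) * catalan x.2 * ((x.2 : ℝ) + 1) =
      (∑ x ∈ antidiagonal n, (catalan x.1 : ℝ) * catalan x.2) * ((n : ℝ) + 2) := by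
    rw [← Finset.sum_add_distrib, Finset.sum_mul]
    refine Finset.sum_congr rfl fun x hx => ?_
    rw [HasAntidiagonal.mem_antidiagonal] at hx
    rw [← hx]
    push_cast
    ring
  rw [h] at h2
  push_cast
  linarith

lemma catalan_ratio (n : ℕ) :
    (catalan (n + 1) : ℝ) / catalan n = 4 - 6 / ((n : ℝ) + 2) := by
  have h := succ_mul_catalan_eq_centralBinom n
  have h' := succ_mul_catalan_eq_centralBinom (n + 1)
  have h2 := Nat.succ_mul_centralBinom_succ n
  rw [← h, ← h'] at h2
  have h3 : ((n : ℝ) + 1) * (((n : ℝ) + 2) * catalan (n + 1)) =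
      ((n : ℝ) + 1) * (2 * (2 * n + 1) * catalan n) := by
    have : (((n + 1) * ((n + 1 + 1) * catalan (n + 1)) : ℕ) : ℝ) =
      ((2 * (2 * n + 1) * ((n + 1) * catalan n) : ℕ) : ℝ) := by rw [h2]
    push_cast at this
    linarith
  have h4 := mul_left_cancel₀ (by positivity) h3
  have := catalan_pos' n
  field_simp
  linarith

lemma catalan_ratio_tendsto :
    Tendsto (fun n : ℕ => (catalan (n + 2) : ℝ) / catalan (n + 1)) atTop (nhds 4) := by
  have h : ∀ n : ℕ, (catalan (n + 2) : ℝ) / catalan (n + 1) = 4 - 6 / (((n + 3 : ℕ) : ℝ)) := by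
    intro n
    rw [catalan_ratio (n + 1)]
    push_cast
    ring
  simp only [h]
  have h1 : Tendsto (fun n : ℕ => (6 : ℝ) / ((n : ℕ) : ℝ)) atTop (nhds 0) :=
    tendsto_const_div_atTop_nhds_zero_nat 6
  have h2 := (tendsto_add_atTop_iff_nat 3).2 h1
  simpa using h2.const_sub 4

/-! ### symmetries -/

lemma inv123 {n : ℕ} (σ : Equiv.Perm (Fin n)) (h : Avoids σ pattern123) :
    Avoids σ⁻¹ pattern123 := by
  rw [avoids123_iff] at h ⊢
  intro i j k hij hjk h1 h2
  exact h _ _ _ h1 h2 (by simpa using hij) (by simpa using hjk)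

lemma inv132 {n : ℕ} (σ : Equiv.Perm (Fin n)) (h : Avoids σ pattern132) :
    Avoids σ⁻¹ pattern132 := by
  rw [avoids132_iff] at h ⊢
  intro i j k hij hjk h1 h2
  exact h _ _ _ h1 h2 (by simpa using hij) (by simpa using hjk)

lemma EP_inv {n : ℕ} (f : Equiv.Perm (Fin n) → ℝ) : EP n f = EP n (fun σ => f σ⁻¹) := by
  unfold EP
  congr 1
  refine Finset.sum_bij' (fun σ _ => σ⁻¹) (fun σ _ => σ⁻¹) ?_ ?_ ?_ ?_ ?_
  · intro σ hσ
    simp only [mem_filter, mem_univ, true_and] at hσ ⊢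
    exact inv123 σ hσ
  · intro σ hσ
    simp only [mem_filter, mem_univ, true_and] at hσ ⊢
    exact inv123 σ hσ
  · simp
  · simp
  · simp

lemma EQ_inv {n : ℕ} (f : Equiv.Perm (Fin n) → ℝ) : EQ n f = EQ n (fun σ => f σ⁻¹) := by
  unfold EQ
  congr 1
  refine Finset.sum_bij' (fun σ _ => σ⁻¹) (fun σ _ => σ⁻¹) ?_ ?_ ?_ ?_ ?_
  · intro σ hσ
    simp only [mem_filter, mem_univ, true_and] at hσ ⊢
    exact inv132 σ hσ
  · intro σ hσ
    simp only [mem_filter, mem_univ, true_and] at hσ ⊢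
    exact inv132 σ hσ
  · simp
  · simp
  · simp

/-- reverse complement -/
def rc {n : ℕ} (σ : Equiv.Perm (Fin n)) : Equiv.Perm (Fin n) :=
  Fin.revPerm.trans (σ.trans Fin.revPerm)

lemma rc_apply {n : ℕ} (σ : Equiv.Perm (Fin n)) (i : Fin n) : rc σ i = (σ i.rev).rev := rfl

lemma rc_rc {n : ℕ} (σ : Equiv.Perm (Fin n)) : rc (rc σ) = σ := by
  ext i; simp [rc_apply]

lemma rc123 {n : ℕ} (σ : Equiv.Perm (Fin n)) (h : Avoids σ pattern123) :
    Avoids (rc σ) pattern123 := by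
  rw [avoids123_iff] at h ⊢
  intro i j k hij hjk h1 h2
  simp only [rc_apply, Fin.rev_lt_rev] at h1 h2
  exact h _ _ _ (Fin.rev_lt_rev.2 hjk) (Fin.rev_lt_rev.2 hij) h2 h1

lemma EP_rc {n : ℕ} (f : Equiv.Perm (Fin n) → ℝ) : EP n f = EP n (fun σ => f (rc σ)) := by
  unfold EP
  congr 1
  refine Finset.sum_bij' (fun σ _ => rc σ) (fun σ _ => rc σ) ?_ ?_ ?_ ?_ ?_
  · intro σ hσ
    simp only [mem_filter, mem_univ, true_and] at hσ ⊢
    exact rc123 σ hσ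
  · intro σ hσ
    simp only [mem_filter, mem_univ, true_and] at hσ ⊢
    exact rc123 σ hσ
  · simp [rc_rc]
  · simp [rc_rc]
  · simp [rc_rc]

lemma EP_EQ_first (n : ℕ) (g : ℕ → ℝ) :
    EP (n + 1) (fun σ => g (σ 0 : ℕ)) = EQ (n + 1) (fun σ => g (σ 0 : ℕ)) := by
  unfold EP EQ
  rw [sum_first_eq]

lemma EQ_codim (n : ℕ) :
    EQ (n + 1) (fun σ => (n : ℝ) + 2 - (σ 0 : ℕ)) = (catalan (n + 2) : ℝ) / catalan (n + 1) := by
  unfold EQ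
  rw [sum_first132, qcount_eq]

lemma EQ_const (n : ℕ) (c : ℝ) : EQ n (fun _ => c) = c := by
  unfold EQ
  rw [Finset.sum_const, nsmul_eq_mul]
  change (qcount n : ℝ) * c / _ = c
  rw [qcount_eq]
  have := catalan_pos' n
  field_simp

lemma EQ_sub (n : ℕ) (f g : Equiv.Perm (Fin n) → ℝ) :
    EQ n (fun σ => f σ - g σ) = EQ n f - EQ n g := by
  unfold EQ
  rw [Finset.sum_sub_distrib, sub_div]

lemma EP_first (n : ℕ) : EP (n + 1) (fun σ => ((σ 0 : ℕ) : ℝ) + 1) =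
    (n : ℝ) + 3 - (catalan (n + 2) : ℝ) / catalan (n + 1) := by
  rw [EP_EQ_first n (fun k => (k : ℝ) + 1), ← EQ_codim]
  have h := EQ_sub (n + 1) (fun _ => (n : ℝ) + 3) (fun σ => (n : ℝ) + 2 - (σ 0 : ℕ))
  rw [EQ_const] at h
  rw [← h]
  congr 1
  ext σ
  ring

lemma EP_last (n : ℕ) : EP (n + 1) (fun σ => ((σ (Fin.last n) : ℕ) : ℝ) + 1) =
    (catalan (n + 2) : ℝ) / catalan (n + 1) - 1 := by
  rw [EP_rc]
  have e : (fun σ : Equiv.Perm (Fin (n + 1)) => ((rc σ (Fin.last n) : ℕ) : ℝ) + 1) =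
      fun σ => (fun k : ℕ => (n : ℝ) + 2 - k - 1) (σ 0 : ℕ) := by
    ext σ
    have := (σ 0).is_le
    simp only [rc_apply, Fin.rev_last, Fin.val_rev]
    rw [Nat.cast_sub (by omega)]
    push_cast
    ring
  rw [e, EP_EQ_first n (fun k : ℕ => (n : ℝ) + 2 - k - 1), ← EQ_codim]
  have h := EQ_sub (n + 1) (fun σ => (n : ℝ) + 2 - (σ 0 : ℕ)) (fun _ => 1)
  rw [EQ_const] at h
  rw [← h]

/-- Expected first and last entries of random pattern-avoiding permutations
(permutation size `n + 1`, entries 1-indexed so the value at `i : Fin (n+1)` is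
`σ i + 1`):
(1) `E[σ(1)] = E[σ⁻¹(1)] = E[τ(1)] = E[τ⁻¹(1)]` for every `n`, and this common value
minus `(n - 2)` tends to `0`;
(2) `E[σ(n)] = E[σ⁻¹(n)]` for every `n`, and `E[σ(n)] → 3`;
(3) `E[τ(n)] = E[τ⁻¹(n)] = (n+1)/2` for every `n`. -/
theorem expected_first_last :
    (∀ n : ℕ,
      EP (n + 1) (fun σ => ((σ 0 : ℕ) : ℝ) + 1) =
          EP (n + 1) (fun σ => ((σ⁻¹ 0 : ℕ) : ℝ) + 1) ∧
      EP (n + 1) (fun σ => ((σ 0 : ℕ) : ℝ) + 1) =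
          EQ (n + 1) (fun τ => ((τ 0 : ℕ) : ℝ) + 1) ∧
      EQ (n + 1) (fun τ => ((τ 0 : ℕ) : ℝ) + 1) =
          EQ (n + 1) (fun τ => ((τ⁻¹ 0 : ℕ) : ℝ) + 1)) ∧
    Tendsto (fun n : ℕ =>
        EP (n + 1) (fun σ => ((σ 0 : ℕ) : ℝ) + 1) - (((n : ℝ) + 1) - 2))
      atTop (nhds 0) ∧
    (∀ n : ℕ,
      EP (n + 1) (fun σ => ((σ (Fin.last n) : ℕ) : ℝ) + 1) =
        EP (n + 1) (fun σ => ((σ⁻¹ (Fin.last n) : ℕ) : ℝ) + 1)) ∧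
    Tendsto (fun n : ℕ => EP (n + 1) (fun σ => ((σ (Fin.last n) : ℕ) : ℝ) + 1))
      atTop (nhds 3) ∧
    (∀ n : ℕ,
      EQ (n + 1) (fun τ => ((τ (Fin.last n) : ℕ) : ℝ) + 1) =
          EQ (n + 1) (fun τ => ((τ⁻¹ (Fin.last n) : ℕ) : ℝ) + 1) ∧
      EQ (n + 1) (fun τ => ((τ (Fin.last n) : ℕ) : ℝ) + 1) = ((n : ℝ) + 2) / 2) := by
  refine ⟨fun n => ⟨EP_inv _, EP_EQ_first n (fun k => (k : ℝ) + 1), EQ_inv _⟩, ?_,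
    fun n => EP_inv _, ?_, fun n => ⟨EQ_inv _, ?_⟩⟩
  · have h := catalan_ratio_tendsto.const_sub 4
    rw [sub_self] at h
    refine h.congr fun n => ?_
    rw [EP_first]
    ring
  · simp only [EP_last]
    have h := catalan_ratio_tendsto.sub_const 1
    norm_num at h
    exact h
  · unfold EQ
    rw [sum_last_val]
    have := catalan_pos' (n + 1)
    field_simp
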